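/- (Lemma 2, unstable solutions; corrected constant.) Let ω ∈ ℝ, κ > 0, τ > 0 with 2κτ > π, and define f(Ω) = Ω − ω + κ·sin(Ωτ). Then the number of real solutions Ω of f(Ω) = 0 satisfying cos(Ωτ) ≤ 0 is at least κτ/π − 3/2. (These correspond to the linearly unstable synchronous solutions of the delayed ring, for which K = κ·cos(Ωτ) < 0.) -/

import Mathlib

open Real

/-- The equation `x - a + b * sin x = 0` has a solution in the interval
`[π / 2 + 2πl, 3π / 2 + 2πl]` whenever the left-hand side changes sign there. -/
lemma exists_sub_add_mul_sin_eq_zero {a b : ℝ} {l : ℤ}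
    (h₁ : a - b - π / 2 ≤ l * (2 * π)) (h₂ : l * (2 * π) ≤ a + b - 3 * π / 2) :
    ∃ x ∈ Set.Icc (π / 2 + l * (2 * π)) (3 * π / 2 + l * (2 * π)),
      x - a + b * sin x = 0 := by
  have hs₁ : sin (π / 2 + l * (2 * π)) = 1 := by
    rw [sin_add_int_mul_two_pi, sin_pi_div_two]
  have hs₂ : sin (3 * π / 2 + l * (2 * π)) = -1 := by
    rw [sin_add_int_mul_two_pi, show 3 * π / 2 = π / 2 + π by ring, sin_add_pi, sin_pi_div_two]
  refine intermediate_value_Icc' (f := fun x ↦ x - a + b * sin x)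
    (by linarith [pi_pos]) (by fun_prop) ⟨?_, ?_⟩
  · simp only [hs₂]
    linarith
  · simp only [hs₁]
    linarith

lemma cos_nonpos_of_mem_Icc_add_int_mul_two_pi {x : ℝ} {l : ℤ}
    (hx : x ∈ Set.Icc (π / 2 + l * (2 * π)) (3 * π / 2 + l * (2 * π))) : cos x ≤ 0 := by
  rw [← cos_sub_int_mul_two_pi x l]
  exact cos_nonpos_of_pi_div_two_le_of_le (by linarith [hx.1]) (by linarith [hx.2])

/-- The intervals `[π / 2 + 2πl, 3π / 2 + 2πl]` are pairwise disjoint. -/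
lemma le_of_mem_Icc_add_int_mul_two_pi {x : ℝ} {l m : ℤ}
    (hl : x ∈ Set.Icc (π / 2 + l * (2 * π)) (3 * π / 2 + l * (2 * π)))
    (hm : x ∈ Set.Icc (π / 2 + m * (2 * π)) (3 * π / 2 + m * (2 * π))) : l ≤ m := by
  by_contra! hlt
  have hlt' : (m : ℝ) + 1 ≤ l := by exact_mod_cast hlt
  nlinarith [hl.1, hm.2, pi_pos]

lemma sub_sub_one_le_card_Icc_ceil_floor (A B : ℝ) :
    B - A - 1 ≤ ((Finset.Icc ⌈A⌉ ⌊B⌋).card : ℝ) := by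
  rw [Int.card_Icc]
  have hle : ((⌊B⌋ + 1 - ⌈A⌉ : ℤ) : ℝ) ≤ ((⌊B⌋ + 1 - ⌈A⌉).toNat : ℝ) := by
    exact_mod_cast Int.self_le_toNat _
  push_cast at hle
  linarith [Int.lt_floor_add_one B, Int.ceil_lt_add_one A]

/-- Lemma 2, unstable solutions; corrected constant. For
`κ > 0`, `τ > 0` with `2κτ > π`, the number of real zeros `Ω` of
`f(Ω) = Ω − ω + κ·sin(Ωτ)` with `cos(Ωτ) ≤ 0` is at least `κτ/π − 3/2`. -/
theorem number_of_unstable_synchronous_solutions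
    (ω κ τ : ℝ) (hκ : 0 < κ) (hτ : 0 < τ) (h : π < 2 * κ * τ) :
    ∃ s : Finset ℝ,
      (∀ Ω ∈ s, Ω - ω + κ * Real.sin (Ω * τ) = 0 ∧ Real.cos (Ω * τ) ≤ 0) ∧
      κ * τ / π - 3 / 2 ≤ (s.card : ℝ) := by
  have hπ : 0 < 2 * π := two_pi_pos
  set A := (ω * τ - κ * τ - π / 2) / (2 * π) with hA
  set B := (ω * τ + κ * τ - 3 * π / 2) / (2 * π) with hB
  have hex : ∀ l : Finset.Icc ⌈A⌉ ⌊B⌋,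
      ∃ x ∈ Set.Icc (π / 2 + (l : ℤ) * (2 * π)) (3 * π / 2 + (l : ℤ) * (2 * π)),
        x - ω * τ + κ * τ * sin x = 0 := by
    rintro ⟨l, hl⟩
    rw [Finset.mem_Icc, Int.ceil_le, Int.le_floor] at hl
    exact exists_sub_add_mul_sin_eq_zero ((div_le_iff₀ hπ).1 hl.1) ((le_div_iff₀ hπ).1 hl.2)
  choose x hx hx₀ using hex
  have hinj : Function.Injective fun l ↦ x l / τ := by
    intro l m hlm
    have hxe : x l = x m := (div_left_inj' hτ.ne').1 hlm
    have hm := hx m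
    rw [← hxe] at hm
    exact Subtype.ext (le_antisymm (le_of_mem_Icc_add_int_mul_two_pi (hx l) hm)
      (le_of_mem_Icc_add_int_mul_two_pi hm (hx l)))
  refine ⟨Finset.univ.image fun l ↦ x l / τ, ?_, ?_⟩
  · intro Ω hΩ
    obtain ⟨l, -, rfl⟩ := Finset.mem_image.1 hΩ
    rw [div_mul_cancel₀ _ hτ.ne']
    refine ⟨?_, cos_nonpos_of_mem_Icc_add_int_mul_two_pi (hx l)⟩
    field_simp
    linarith [hx₀ l]
  · rw [Finset.card_image_of_injective _ hinj, Finset.card_univ, Fintype.card_coe]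
    refine le_trans (le_of_eq ?_) (sub_sub_one_le_card_Icc_ceil_floor A B)
    rw [hA, hB]
    field_simp
    ring
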